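/- For all integers p > 2, m < 0 and n > 0, the matrix Q_p(m,n) is negative definite; that is, xᵀ·Q_p(m,n)·x < 0 for every nonzero real vector x ∈ ℝ^{np} (equivalently, −Q_p(m,n) is positive definite). -/

import Mathlib

open Matrix

/-- The intersection form `Q_p(m,n)`: a symmetric integer matrix of size `n * p`,
with rows and columns indexed by pairs `(k, i)`, `k ∈ {0,…,n-1}` (block index) and
`i ∈ ℤ/p` (cyclic index, realized as `Fin p` with mod-`p` arithmetic). Entries:
`Q((0,i),(0,i)) = 2m-1`; `Q((0,i),(0,j)) = -m` if `j = i ± 1 (mod p)`;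
`Q((k,i),(k,i)) = -2` for `k ≥ 1`; `Q((k,i),(k',i)) = 1` if `|k - k'| = 1`;
all other entries `0`. -/
def Qmat (p n : ℕ) (m : ℤ) : Matrix (Fin n × Fin p) (Fin n × Fin p) ℤ :=
  Matrix.of fun x y =>
    if x.1 = y.1 then
      if (x.1 : ℕ) = 0 then
        if x.2 = y.2 then 2 * m - 1
        else if ((x.2 : ℕ) + 1) % p = (y.2 : ℕ) ∨ ((y.2 : ℕ) + 1) % p = (x.2 : ℕ) then -m
        else 0
      else if x.2 = y.2 then -2 else 0
    else if x.2 = y.2 ∧ ((x.1 : ℕ) + 1 = (y.1 : ℕ) ∨ (y.1 : ℕ) + 1 = (x.1 : ℕ)) then 1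
    else 0

/-- cyclic successor -/
def cycS (p : ℕ) (i : Fin p) : Fin p := ⟨((i : ℕ) + 1) % p, Nat.mod_lt _ (by have := i.2; omega)⟩

theorem cycS_val (p : ℕ) (i : Fin p) :
    ((i : ℕ) + 1 < p ∧ (cycS p i : ℕ) = i + 1) ∨ ((i : ℕ) + 1 = p ∧ (cycS p i : ℕ) = 0) := by
  have hi := i.2
  rcases Nat.lt_or_ge ((i : ℕ) + 1) p with h | h
  · left; exact ⟨h, Nat.mod_eq_of_lt h⟩
  · right
    have h2 : (i : ℕ) + 1 = p := by omega
    refine ⟨h2, ?_⟩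
    simp [cycS, h2]

theorem cycS_bij (p : ℕ) : Function.Bijective (cycS p) := by
  apply Finite.injective_iff_bijective.mp
  intro i j h
  have h' : (cycS p i : ℕ) = cycS p j := by rw [h]
  have h1 := cycS_val p i
  have h2 := cycS_val p j
  ext
  omega

/-- extension by zero -/
def zext (n : ℕ) (f : Fin n → ℝ) (k : ℕ) : ℝ := if h : k < n then f ⟨k, h⟩ else 0

theorem zext_val (n : ℕ) (f : Fin n → ℝ) (k : Fin n) : zext n f k = f k := by
  simp [zext]

/-- chain coefficients -/
def chainC (n : ℕ) (k l : Fin n) : ℝ :=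
  (if k = l then (if (k : ℕ) = 0 then -1 else -2) else 0)
    + (if (k : ℕ) + 1 = l then 1 else 0) + (if (l : ℕ) + 1 = k then 1 else 0)

theorem off_sum (n : ℕ) (f : Fin n → ℝ) :
    ∑ k : Fin n, ∑ l : Fin n, (if (k : ℕ) + 1 = (l : ℕ) then 1 else 0) * (f k * f l)
      = ∑ k ∈ Finset.range n, zext n f k * zext n f (k + 1) := by
  rw [Finset.sum_range]
  refine Finset.sum_congr rfl fun k _ => ?_
  rw [zext_val]
  by_cases h : (k : ℕ) + 1 < n
  · rw [Finset.sum_eq_single (⟨k + 1, h⟩ : Fin n)]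
    · simp [zext, h]
    · intro b _ hb
      rw [if_neg, zero_mul]
      intro h'; exact hb (Fin.ext h'.symm)
    · simp
  · rw [Finset.sum_eq_zero]
    · simp [zext, h]
    · intro b _
      rw [if_neg, zero_mul]
      have := b.2; omega

theorem chain_sum (n : ℕ) (hn : 0 < n) (f : Fin n → ℝ) :
    ∑ k, ∑ l, chainC n k l * (f k * f l)
      = -∑ k ∈ Finset.range n, (zext n f k - zext n f (k + 1)) ^ 2 := by
  have hd : ∑ k : Fin n, ∑ l : Fin n,
      (if k = l then (if (k : ℕ) = 0 then (-1 : ℝ) else -2) else 0) * (f k * f l)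
      = ∑ k ∈ Finset.range n, (-2 * zext n f k ^ 2) + zext n f 0 ^ 2 := by
    have h0 : zext n f 0 ^ 2
        = ∑ k ∈ Finset.range n, if k = 0 then zext n f k ^ 2 else 0 := by
      rw [Finset.sum_ite_eq']; simp [hn]
    rw [h0, ← Finset.sum_add_distrib, Finset.sum_range]
    refine Finset.sum_congr rfl fun k _ => ?_
    simp only [ite_mul, zero_mul, Finset.sum_ite_eq, Finset.mem_univ, if_true, zext_val]
    split_ifs <;> ring
  have ho := off_sum n f
  have ho' : ∑ k : Fin n, ∑ l : Fin n, (if (l : ℕ) + 1 = (k : ℕ) then 1 else 0) * (f k * f l)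
      = ∑ k ∈ Finset.range n, zext n f k * zext n f (k + 1) := by
    rw [← ho, Finset.sum_comm]
    refine Finset.sum_congr rfl fun k _ => Finset.sum_congr rfl fun l _ => ?_
    ring
  have ht : ∑ k ∈ Finset.range n, zext n f (k + 1) ^ 2 + zext n f 0 ^ 2
      = ∑ k ∈ Finset.range n, zext n f k ^ 2 := by
    rw [← Finset.sum_range_succ' (fun k => zext n f k ^ 2), Finset.sum_range_succ]
    simp [zext]
  simp only [chainC, add_mul, Finset.sum_add_distrib]
  rw [hd, ho, ho']
  simp only [sub_sq, Finset.sum_add_distrib, Finset.sum_sub_distrib, mul_assoc, ← Finset.mul_sum]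
  linarith

/-- cycle coefficients -/
def cycC (p : ℕ) (i j : Fin p) : ℝ :=
  (if i = j then 2 else 0) - (if cycS p i = j then 1 else 0) - (if cycS p j = i then 1 else 0)

theorem cyc_sum (p : ℕ) (y : Fin p → ℝ) :
    ∑ i, ∑ j, cycC p i j * (y i * y j) = ∑ i, (y i - y (cycS p i)) ^ 2 := by
  have h3 : ∑ i : Fin p, ∑ j : Fin p, (if cycS p j = i then (1 : ℝ) else 0) * (y i * y j)
      = ∑ i, y i * y (cycS p i) := by
    rw [Finset.sum_comm]
    refine Finset.sum_congr rfl fun k _ => ?_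
    simp [mul_comm]
  have h4 : ∑ i, y (cycS p i) ^ 2 = ∑ i, y i ^ 2 :=
    (cycS_bij p).sum_comp (fun i => y i ^ 2)
  simp only [cycC, sub_mul, Finset.sum_sub_distrib]
  rw [h3]
  simp only [ite_mul, zero_mul, one_mul, Finset.sum_ite_eq, Finset.mem_univ, if_true,
    sub_sq, Finset.sum_add_distrib, Finset.sum_sub_distrib, mul_assoc, ← Finset.mul_sum, h4]
  simp only [← sq]
  linarith

theorem Qmat_entry (p n : ℕ) (m : ℤ) (hp : 2 < p) (k l : Fin n) (i j : Fin p) :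
    ((Qmat p n m (k, i) (l, j) : ℤ) : ℝ)
      = (if k = l then (if (k : ℕ) = 0 then (m : ℝ) * cycC p i j else 0) else 0)
        + (if i = j then chainC n k l else 0) := by
  have h1 := cycS_val p i
  have h2 := cycS_val p j
  have e1 : (((i : ℕ) + 1) % p = (j : ℕ)) ↔ cycS p i = j := by simp [cycS, Fin.ext_iff]
  have e2 : (((j : ℕ) + 1) % p = (i : ℕ)) ↔ cycS p j = i := by simp [cycS, Fin.ext_iff]
  simp only [Qmat, Matrix.of_apply, e1, e2, cycC, chainC]
  simp only [Fin.ext_iff]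
  generalize (cycS p i : ℕ) = a at *
  generalize (cycS p j : ℕ) = b at *
  split_ifs <;> first | (exfalso; omega) | (push_cast; ring)

theorem Qmat_form (p n : ℕ) (m : ℤ) (hp : 2 < p) (hn : 0 < n) (x : Fin n × Fin p → ℝ) :
    x ⬝ᵥ ((Qmat p n m).map (fun a => (a : ℝ))).mulVec x
      = (m : ℝ) * ∑ i, (x (⟨0, hn⟩, i) - x (⟨0, hn⟩, cycS p i)) ^ 2
        - ∑ i, ∑ k ∈ Finset.range n,
          (zext n (fun k => x (k, i)) k - zext n (fun k => x (k, i)) (k + 1)) ^ 2 := by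
  have hc : ∀ i, ∑ k ∈ Finset.range n,
      (zext n (fun k => x (k, i)) k - zext n (fun k => x (k, i)) (k + 1)) ^ 2
      = - ∑ k, ∑ l, chainC n k l * (x (k, i) * x (l, i)) := fun i => by
    rw [chain_sum n hn (fun k => x (k, i)), neg_neg]
  simp only [hc]
  rw [← cyc_sum p (fun i => x (⟨0, hn⟩, i)), Finset.sum_neg_distrib, sub_neg_eq_add]
  have : x ⬝ᵥ ((Qmat p n m).map (fun a => (a : ℝ))).mulVec x
      = ∑ k : Fin n, ∑ i : Fin p, ∑ l : Fin n, ∑ j : Fin p,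
        ((if k = l then (if (k : ℕ) = 0 then (m : ℝ) * cycC p i j else 0) else 0)
        + (if i = j then chainC n k l else 0)) * (x (k, i) * x (l, j)) := by
    simp only [dotProduct, Matrix.mulVec, Fintype.sum_prod_type, Matrix.map_apply,
      Qmat_entry p n m hp, Finset.mul_sum]
    refine Finset.sum_congr rfl fun k _ => Finset.sum_congr rfl fun i _ =>
      Finset.sum_congr rfl fun l _ => Finset.sum_congr rfl fun j _ => ?_
    ring
  rw [this]
  simp only [add_mul, Finset.sum_add_distrib]
  congr 1
  · rw [Finset.sum_eq_single (⟨0, hn⟩ : Fin n)]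
    · rw [Finset.mul_sum]
      refine Finset.sum_congr rfl fun i _ => ?_
      rw [Finset.sum_eq_single (⟨0, hn⟩ : Fin n)]
      · simp [Finset.mul_sum, mul_assoc]
      · intro b _ hb
        simp [Ne.symm hb]
      · simp
    · intro b _ hb
      have : (b : ℕ) ≠ 0 := fun h => hb (Fin.ext h)
      simp [this]
    · simp
  · rw [Finset.sum_comm]
    simp

/-- Lemma 3.1 (intersection-form version): for `p > 2`, `m < 0` and `n > 0`, the
matrix `Q_p(m,n)` is negative definite: `xᵀ Q x < 0` for every nonzero real
vector `x`. -/
theorem Qmat_negDef (p n : ℕ) (m : ℤ) (hp : 2 < p) (hm : m < 0) (hn : 0 < n) :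
    ∀ x : Fin n × Fin p → ℝ, x ≠ 0 →
      x ⬝ᵥ ((Qmat p n m).map (fun a => (a : ℝ))).mulVec x < 0 := by
  intro x hx
  rw [Qmat_form p n m hp hn x]
  have hm' : (m : ℝ) < 0 := by exact_mod_cast hm
  have hA : (m : ℝ) * ∑ i, (x (⟨0, hn⟩, i) - x (⟨0, hn⟩, cycS p i)) ^ 2 ≤ 0 :=
    mul_nonpos_of_nonpos_of_nonneg hm'.le (Finset.sum_nonneg fun i _ => sq_nonneg _)
  have hB0 : ∀ i ∈ Finset.univ, 0 ≤ ∑ k ∈ Finset.range n,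
      (zext n (fun k => x (k, i)) k - zext n (fun k => x (k, i)) (k + 1)) ^ 2 :=
    fun i _ => Finset.sum_nonneg fun k _ => sq_nonneg _
  have hB := Finset.sum_nonneg hB0
  rcases hB.lt_or_eq with h | h
  · linarith
  · exfalso
    apply hx
    have h1 := (Finset.sum_eq_zero_iff_of_nonneg hB0).mp h.symm
    funext ⟨k, i⟩
    have h2 := (Finset.sum_eq_zero_iff_of_nonneg (fun k _ => sq_nonneg _)).mp
      (h1 i (Finset.mem_univ i))
    have h3 : ∀ d c, c + d = n → zext n (fun k => x (k, i)) c = 0 := by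
      intro d
      induction d with
      | zero => intro c hc; simp [zext, show ¬ c < n by omega]
      | succ d ih =>
        intro c hc
        have e := h2 c (Finset.mem_range.mpr (by omega))
        have e' := pow_eq_zero_iff (two_ne_zero) |>.mp e
        rw [ih (c + 1) (by omega)] at e'
        linarith
    have h4 := h3 (n - k) k (by have := k.2; omega)
    rw [zext_val] at h4
    exact h4
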